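/- Let K be the field of fractions of the polynomial ring ℚ[a,b,i,j,k,r,s] in seven indeterminates, and in K set c := a+b, m := c·i + a·k + a·c·r, n := c·j + b·k + b·c·r, d := i + j + k + c·r. Define Z := −s/(s+1) · (c·r)/((m·s+a+c)·(n·s+b+c)) + b/((i·s+1)·(j·s+1)·(n·s+b+c)) + (a·c)/((n·s+b+c)·(m·s+a+c)·(i·s+1)) + c²/((k·s+1)·(n·s+b+c)·(m·s+a+c)), Z1 := −s/(s+1) · r/(m·s+a+c) + c/((m·s+a+c)·(k·s+1)) + a/((m·s+a+c)·(i·s+1)), Z2 := −s/(s+1) · r/(n·s+b+c) + c/((n·s+b+c)·(k·s+1)) + b/((n·s+b+c)·(j·s+1)), and R := 1/((i·s+1)·(j·s+1)). Then in K one has the identity (d·s+3)·Z = Z1 + Z2 + R. -/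

import Mathlib

open MvPolynomial

/-- The cancellation identity in the fraction field `K` of `ℚ[a,b,i,j,k,r,s]`:
with `c = a+b`, `m = c·i + a·k + a·c·r`, `n = c·j + b·k + b·c·r`,
`d = i + j + k + c·r`, one has `(d·s+3)·Z = Z1 + Z2 + R`. -/
theorem stmt0
    (K : Type) [Field K] [Algebra (MvPolynomial (Fin 7) ℚ) K]
    [IsFractionRing (MvPolynomial (Fin 7) ℚ) K]
    (a b i j k r s : K)
    (ha : a = algebraMap (MvPolynomial (Fin 7) ℚ) K (X 0))
    (hb : b = algebraMap (MvPolynomial (Fin 7) ℚ) K (X 1))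
    (hi : i = algebraMap (MvPolynomial (Fin 7) ℚ) K (X 2))
    (hj : j = algebraMap (MvPolynomial (Fin 7) ℚ) K (X 3))
    (hk : k = algebraMap (MvPolynomial (Fin 7) ℚ) K (X 4))
    (hr : r = algebraMap (MvPolynomial (Fin 7) ℚ) K (X 5))
    (hs : s = algebraMap (MvPolynomial (Fin 7) ℚ) K (X 6))
    (c m n d Z Z1 Z2 R : K)
    (hc : c = a + b)
    (hm : m = c * i + a * k + a * c * r)
    (hn : n = c * j + b * k + b * c * r)
    (hd : d = i + j + k + c * r)
    (hZ : Z = -s / (s + 1) * (c * r / ((m * s + a + c) * (n * s + b + c)))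
        + b / ((i * s + 1) * (j * s + 1) * (n * s + b + c))
        + a * c / ((n * s + b + c) * (m * s + a + c) * (i * s + 1))
        + c ^ 2 / ((k * s + 1) * (n * s + b + c) * (m * s + a + c)))
    (hZ1 : Z1 = -s / (s + 1) * (r / (m * s + a + c))
        + c / ((m * s + a + c) * (k * s + 1))
        + a / ((m * s + a + c) * (i * s + 1)))
    (hZ2 : Z2 = -s / (s + 1) * (r / (n * s + b + c))
        + c / ((n * s + b + c) * (k * s + 1))
        + b / ((n * s + b + c) * (j * s + 1)))
    (hR : R = 1 / ((i * s + 1) * (j * s + 1))) :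
    (d * s + 3) * Z = Z1 + Z2 + R := by
  have key : ∀ p : MvPolynomial (Fin 7) ℚ, ∀ v : Fin 7 → ℚ, MvPolynomial.eval v p ≠ 0 →
      algebraMap (MvPolynomial (Fin 7) ℚ) K p ≠ 0 := by
    intro p v hv h0
    apply hv
    have hp : p = 0 := by
      apply IsFractionRing.injective (MvPolynomial (Fin 7) ℚ) K
      rw [h0, map_zero]
    rw [hp, map_zero]
  have hS : s + 1 ≠ 0 := by
    have h := key (X 6 + 1) (fun _ => 1) (by norm_num)
    simpa [hs] using h
  have hI : i * s + 1 ≠ 0 := by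
    have h := key (X 2 * X 6 + 1) (fun _ => 1) (by norm_num)
    simpa [hs, hi] using h
  have hJ : j * s + 1 ≠ 0 := by
    have h := key (X 3 * X 6 + 1) (fun _ => 1) (by norm_num)
    simpa [hs, hj] using h
  have hQ : k * s + 1 ≠ 0 := by
    have h := key (X 4 * X 6 + 1) (fun _ => 1) (by norm_num)
    simpa [hs, hk] using h
  have hM : m * s + a + c ≠ 0 := by
    have h := key (((X 0 + X 1) * X 2 + X 0 * X 4 + X 0 * (X 0 + X 1) * X 5) * X 6
      + X 0 + (X 0 + X 1)) (fun _ => 1) (by norm_num)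
    simpa only [hm, hc, ha, hb, hi, hk, hr, hs, map_add, map_mul] using h
  have hN : n * s + b + c ≠ 0 := by
    have h := key (((X 0 + X 1) * X 3 + X 1 * X 4 + X 1 * (X 0 + X 1) * X 5) * X 6
      + X 1 + (X 0 + X 1)) (fun _ => 1) (by norm_num)
    simpa only [hn, hc, ha, hb, hj, hk, hr, hs, map_add, map_mul] using h
  clear ha hb hi hj hk hr hs key
  obtain ⟨M, hMe⟩ : ∃ M, M = m * s + a + c := ⟨_, rfl⟩
  obtain ⟨N, hNe⟩ : ∃ N, N = n * s + b + c := ⟨_, rfl⟩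
  rw [← hMe] at hZ hZ1 hM
  rw [← hNe] at hZ hZ2 hN
  rw [hZ, hZ1, hZ2, hR]
  clear hZ hZ1 hZ2 hR
  obtain ⟨I, hIe⟩ : ∃ I, I = i * s + 1 := ⟨_, rfl⟩
  obtain ⟨J, hJe⟩ : ∃ J, J = j * s + 1 := ⟨_, rfl⟩
  obtain ⟨Q, hQe⟩ : ∃ Q, Q = k * s + 1 := ⟨_, rfl⟩
  obtain ⟨S, hSe⟩ : ∃ S, S = s + 1 := ⟨_, rfl⟩
  rw [← hIe] at hI ⊢
  rw [← hJe] at hJ ⊢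
  rw [← hQe] at hQ ⊢
  rw [← hSe] at hS ⊢
  field_simp
  subst hMe hNe hIe hJe hQe hSe hm hn hd hc
  ring
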